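/- arXiv:1903.07010 — 5 statements merged into one kernel-verified Lean document; each statement's English description precedes it below -/
import Mathlib

section
/- Let F ∈ k[x₀,…,xₙ] be homogeneous of degree n+1 with n ≥ 1, and let c ∈ k be the coefficient of x₀^{n} in ∂₀F. Then, in the localization A of k[x₀,…,xₙ] away from x₁⋯xₙ, the element ∂₀F/(x₁⋯xₙ) − c·x₀^{n}/(x₁⋯xₙ) lies in the submodule ∑_{i=1}^{n} Aᵢ. (Every monomial of ∂₀F other than x₀^n is divisible by some xᵢ with i ≥ 1, so modulo Čech coboundaries the cocycle ∂₀F/(x₁⋯xₙ) of Lemma 3.1 reduces to c·x₀^n/(x₁⋯xₙ).) -/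
open MvPolynomial

noncomputable section

/-- The product `x₁⋯xₙ` in `k[x₀,…,xₙ]`. -/
def cechDenom (k : Type*) [Field k] (n : ℕ) : MvPolynomial (Fin (n + 1)) k :=
  ∏ j ∈ Finset.univ.erase (0 : Fin (n + 1)), X j

/-- The localization `A` of `k[x₀,…,xₙ]` away from `x₁⋯xₙ`. -/
abbrev CechLoc (k : Type*) [Field k] (n : ℕ) := Localization.Away (cechDenom k n)

/-- The `R`-submodule `Aᵢ ⊆ A` of elements of the form `p/(x₁⋯x̂ᵢ⋯xₙ)ᵐ`, i.e. the image in
`A` of the localization of `R` away from `∏_{1 ≤ j ≤ n, j ≠ i} xⱼ`. -/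
def cechSub (k : Type*) [Field k] (n : ℕ) (i : Fin (n + 1)) :
    Submodule (MvPolynomial (Fin (n + 1)) k) (CechLoc k n) :=
  Submodule.span (MvPolynomial (Fin (n + 1)) k)
    {a : CechLoc k n | ∃ (p : MvPolynomial (Fin (n + 1)) k) (m : ℕ),
      a * algebraMap (MvPolynomial (Fin (n + 1)) k) (CechLoc k n)
          ((∏ j ∈ (Finset.univ.erase (0 : Fin (n + 1))).erase i, X j) ^ m) =
        algebraMap (MvPolynomial (Fin (n + 1)) k) (CechLoc k n) p}

theorem mk_mem_cechSub (k : Type*) [Field k] (n : ℕ) (i : Fin (n + 1)) (hi : i ≠ 0)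
    (q : MvPolynomial (Fin (n + 1)) k) :
    (Localization.mk (X i * q) ⟨cechDenom k n, Submonoid.mem_powers _⟩ : CechLoc k n) ∈
      cechSub k n i := by
  apply Submodule.subset_span
  refine ⟨q, 1, ?_⟩
  rw [← Localization.mk_one_eq_algebraMap, ← Localization.mk_one_eq_algebraMap,
    Localization.mk_mul, Localization.mk_eq_mk_iff, Localization.r_iff_exists]
  refine ⟨1, ?_⟩
  have h : cechDenom k n =
      X i * ∏ j ∈ (Finset.univ.erase (0 : Fin (n + 1))).erase i, X j :=
    (Finset.mul_prod_erase _ _ (by simp [hi])).symm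
  simp only [OneMemClass.coe_one, one_mul, mul_one, pow_one]
  rw [h]
  ring

theorem mk_mem_iSup_cechSub (k : Type*) [Field k] (n : ℕ)
    (g : MvPolynomial (Fin (n + 1)) k)
    (hg : ∀ s ∈ g.support, ∃ i : Fin (n + 1), i ≠ 0 ∧ s i ≠ 0) :
    (Localization.mk g ⟨cechDenom k n, Submonoid.mem_powers _⟩ : CechLoc k n) ∈
      ⨆ (i : Fin (n + 1)) (_ : i ≠ 0), cechSub k n i := by
  have hsum : (Localization.mk g ⟨cechDenom k n, Submonoid.mem_powers _⟩ : CechLoc k n) =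
      ∑ s ∈ g.support, Localization.mk (monomial s (coeff s g))
        ⟨cechDenom k n, Submonoid.mem_powers _⟩ := by
    rw [← Localization.mk_sum, ← MvPolynomial.as_sum]
  rw [hsum]
  refine Submodule.sum_mem _ fun s hs => ?_
  obtain ⟨i, hi, hsi⟩ := hg s hs
  have hd : (X i : MvPolynomial (Fin (n + 1)) k) ∣ monomial s (coeff s g) :=
    MvPolynomial.X_dvd_monomial.mpr (Or.inr hsi)
  obtain ⟨q, hq⟩ := hd
  rw [hq]
  exact Submodule.mem_iSup_of_mem i (Submodule.mem_iSup_of_mem hi (mk_mem_cechSub k n i hi q))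

/-- For `F` homogeneous of degree `n+1` and `c` the coefficient of `x₀ⁿ` in `∂₀F`, the element
`∂₀F/(x₁⋯xₙ) − c·x₀ⁿ/(x₁⋯xₙ)` of `A` lies in `∑_{i=1}^{n} Aᵢ`: every monomial of `∂₀F` other
than `x₀ⁿ` is divisible by some `xᵢ` with `i ≥ 1` (proof of Lemma 3.1). -/
theorem pderiv_div_sub_lead_mem_coboundaries (k : Type*) [Field k] [CharZero k] (n : ℕ)
    (hn : 1 ≤ n) (F : MvPolynomial (Fin (n + 1)) k) (hF : F.IsHomogeneous (n + 1)) :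
    (Localization.mk (pderiv 0 F) ⟨cechDenom k n, Submonoid.mem_powers _⟩ : CechLoc k n) -
        Localization.mk (C (coeff (Finsupp.single 0 n) (pderiv 0 F)) * X 0 ^ n)
          ⟨cechDenom k n, Submonoid.mem_powers _⟩ ∈
      ⨆ (i : Fin (n + 1)) (_ : i ≠ 0), cechSub k n i := by
  have hsub : ∀ (a b : MvPolynomial (Fin (n + 1)) k) (d : Submonoid.powers (cechDenom k n)),
      (Localization.mk a d : CechLoc k n) - Localization.mk b d = Localization.mk (a - b) d := by
    intro a b d
    rw [sub_eq_iff_eq_add, Localization.add_mk_self, sub_add_cancel]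
  rw [hsub]
  apply mk_mem_iSup_cechSub
  intro s hs
  by_contra! hcon
  have hs0 : s = Finsupp.single 0 (s 0) := by
    ext j
    by_cases hj : j = 0
    · subst hj; simp
    · rw [hcon j hj, Finsupp.single_eq_of_ne hj]
  have hm : (C (coeff (Finsupp.single 0 n) (pderiv 0 F)) * X 0 ^ n :
      MvPolynomial (Fin (n + 1)) k) =
      monomial (Finsupp.single 0 n) (coeff (Finsupp.single 0 n) (pderiv 0 F)) := by
    rw [X_pow_eq_monomial, C_mul_monomial, mul_one]
  rw [mem_support_iff, coeff_sub, hm, coeff_monomial] at hs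
  by_cases h : Finsupp.single 0 n = s
  · subst h
    simp at hs
  · rw [if_neg h, sub_zero] at hs
    have hh : (pderiv 0 F).IsHomogeneous n := by simpa using hF.pderiv (i := 0)
    have hd := hh hs
    rw [hs0] at hd
    rw [Finsupp.weight_single] at hd
    simp at hd
    apply h
    rw [hs0, hd]
end
end

section
/- For n ≥ 1, the element x₀^{n}/(x₁⋯xₙ) of the localization A of k[x₀,…,xₙ] away from x₁⋯xₙ does not lie in the submodule ∑_{i=1}^{n} Aᵢ. (This is the claim in the proof of Lemma 3.1 that x₀^n/(x₁⋯xₙ) is not a Čech coboundary, unlike all other monomials of that degree.) -/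
open MvPolynomial

noncomputable section

/-- The ideal generated by the powers `xⱼ^M`, `1 ≤ j ≤ n`. -/
def cechI (k : Type*) [Field k] (n M : ℕ) : Ideal (MvPolynomial (Fin (n + 1)) k) :=
  Ideal.span ((fun s => monomial s (1 : k)) '' {s | ∃ j : Fin (n + 1), j ≠ 0 ∧ s = Finsupp.single j M})

lemma X_pow_mem_cechI (k : Type*) [Field k] (n M : ℕ) (j : Fin (n + 1)) (hj : j ≠ 0) :
    (X j : MvPolynomial (Fin (n + 1)) k) ^ M ∈ cechI k n M := by
  rw [X_pow_eq_monomial]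
  exact Ideal.subset_span ⟨_, ⟨j, hj, rfl⟩, rfl⟩

lemma cechDenom_eq (k : Type*) [Field k] (n : ℕ) (i : Fin (n + 1)) (hi : i ≠ 0) :
    cechDenom k n = X i * ∏ j ∈ (Finset.univ.erase (0 : Fin (n + 1))).erase i, X j := by
  rw [cechDenom, Finset.mul_prod_erase _ (fun j => (X j : MvPolynomial (Fin (n + 1)) k))]
  simp [hi]

lemma mul_mem_cechI (k : Type*) [Field k] (n M N : ℕ) (p : MvPolynomial (Fin (n + 1)) k)
    (hp : p ∈ cechI k n M) : p * cechDenom k n ^ N ∈ cechI k n (M + N) := by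
  unfold cechI at hp
  induction hp using Submodule.span_induction with
  | mem x hx =>
    obtain ⟨_, ⟨j, hj, rfl⟩, rfl⟩ := hx
    simp only []
    rw [← X_pow_eq_monomial, cechDenom_eq k n j hj, mul_pow, ← mul_assoc, ← pow_add]
    exact Ideal.mul_mem_right _ _ (X_pow_mem_cechI k n _ j hj)
  | zero => simp
  | add x y _ _ hx hy => rw [add_mul]; exact Ideal.add_mem _ hx hy
  | smul a x _ hx => rw [smul_eq_mul, mul_assoc]; exact Ideal.mul_mem_left _ _ hx

/-- The elements `p / (x₁⋯xₙ)^M` with `p` in the ideal `(x₁^M, …, xₙ^M)`. -/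
def cechS (k : Type*) [Field k] (n : ℕ) :
    Submodule (MvPolynomial (Fin (n + 1)) k) (CechLoc k n) where
  carrier := {a | ∃ (M : ℕ) (p : MvPolynomial (Fin (n + 1)) k), p ∈ cechI k n M ∧
    a * algebraMap _ (CechLoc k n) (cechDenom k n ^ M) = algebraMap _ (CechLoc k n) p}
  zero_mem' := ⟨0, 0, by simp, by simp⟩
  add_mem' := by
    rintro a b ⟨M, p, hp, ha⟩ ⟨N, q, hq, hb⟩
    refine ⟨M + N, p * cechDenom k n ^ N + q * cechDenom k n ^ M,
      Ideal.add_mem _ (mul_mem_cechI k n M N p hp) ?_, ?_⟩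
    · rw [add_comm M N]; exact mul_mem_cechI k n N M q hq
    · rw [map_add, map_mul, map_mul, ← ha, ← hb, pow_add, map_mul]; ring
  smul_mem' := by
    rintro c a ⟨M, p, hp, ha⟩
    refine ⟨M, c * p, Ideal.mul_mem_left _ _ hp, ?_⟩
    rw [map_mul, ← ha, Algebra.smul_def, mul_assoc]

lemma cechSub_le (k : Type*) [Field k] (n : ℕ) (i : Fin (n + 1)) (hi : i ≠ 0) :
    cechSub k n i ≤ cechS k n := by
  refine Submodule.span_le.2 ?_
  rintro a ⟨p, m, h⟩
  refine ⟨m, X i ^ m * p, Ideal.mul_mem_right _ _ (X_pow_mem_cechI k n m i hi), ?_⟩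
  have e : cechDenom k n ^ m =
      X i ^ m * (∏ j ∈ (Finset.univ.erase (0 : Fin (n + 1))).erase i, X j) ^ m := by
    rw [cechDenom_eq k n i hi, mul_pow]
  have e2 := congrArg (algebraMap (MvPolynomial (Fin (n + 1)) k) (CechLoc k n)) e
  rw [e2, map_mul, map_mul, ← h]; ring

lemma cechDenom_ne_zero (k : Type*) [Field k] (n : ℕ) : cechDenom k n ≠ 0 :=
  Finset.prod_ne_zero_iff.2 fun j _ => X_ne_zero j

lemma cechDenom_monomial (k : Type*) [Field k] (n : ℕ) :
    cechDenom k n = monomial (∑ j ∈ Finset.univ.erase (0 : Fin (n + 1)), Finsupp.single j 1) 1 := by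
  rw [monomial_sum_one]; rfl

/-- The element `x₀ⁿ/(x₁⋯xₙ)` of `A` is not a Čech coboundary, i.e. it does not lie in the
submodule `∑_{i=1}^{n} Aᵢ` (proof of Lemma 3.1). -/
theorem X_zero_pow_div_not_mem_coboundaries (k : Type*) [Field k] [CharZero k] (n : ℕ)
    (hn : 1 ≤ n) :
    (Localization.mk (X 0 ^ n) ⟨cechDenom k n, Submonoid.mem_powers _⟩ : CechLoc k n) ∉
      ⨆ (i : Fin (n + 1)) (_ : i ≠ 0), cechSub k n i := by
  intro hmem
  have hS : (Localization.mk (X 0 ^ n) ⟨cechDenom k n, Submonoid.mem_powers _⟩ : CechLoc k n) ∈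
      cechS k n := (iSup₂_le fun i hi => cechSub_le k n i hi) hmem
  obtain ⟨M, p, hp, h⟩ := hS
  have hinj : Function.Injective (algebraMap (MvPolynomial (Fin (n + 1)) k) (CechLoc k n)) :=
    IsLocalization.injective _ (powers_le_nonZeroDivisors_of_noZeroDivisors (cechDenom_ne_zero k n))
  have hmk : (Localization.mk (X 0 ^ n) ⟨cechDenom k n, Submonoid.mem_powers _⟩ : CechLoc k n) *
      algebraMap _ (CechLoc k n) (cechDenom k n) =
      algebraMap (MvPolynomial (Fin (n + 1)) k) (CechLoc k n) (X 0 ^ n) := by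
    rw [Localization.mk_eq_mk']
    exact IsLocalization.mk'_spec _ _ _
  have key : X 0 ^ n * cechDenom k n ^ M = p * cechDenom k n ^ 1 := by
    apply hinj
    rw [map_mul, map_mul, ← h, ← hmk, pow_one]; ring
  have hm := mul_mem_cechI k n M 1 p hp
  rw [← key, cechDenom_monomial, X_pow_eq_monomial, monomial_pow, monomial_mul, cechI,
    mem_ideal_span_monomial_image] at hm
  obtain ⟨s, ⟨j, hj, rfl⟩, hle⟩ := hm _ (by
    rw [mem_support_iff, coeff_monomial, if_pos rfl]; simp)
  have := hle j
  simp [Finsupp.single_apply, hj] at this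
end
end

section
/- Let n ≥ 3, let k have characteristic 0, and let F ∈ k[x₀,…,xₙ] be homogeneous of degree n+1 with nonzero coefficient of x₀^{n+1} (so the point [1 : 0 : ⋯ : 0] does not lie on the hypersurface X = V(F)). Then, in the localization A of k[x₀,…,xₙ] away from x₁⋯xₙ, the element ∂₀F/(x₁⋯xₙ) does not lie in the submodule ∑_{i=1}^{n} Aᵢ + F·A. (This is the nonvanishing half of Lemma 3.1: the Čech cocycle ∂₀F/(x₁⋯xₙ) represents a nonzero class in H^{n−1}(X, O_X), the submodule ∑ Aᵢ + F·A being the Čech coboundaries of the standard affine cover of X together with the relations coming from F.) -/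
open MvPolynomial

noncomputable section

/-- Polynomials all of whose monomials are divisible by some `xᵢ^N`, `i ≠ 0`. -/
def bigIdeal (k : Type*) [Field k] (n N : ℕ) : Ideal (MvPolynomial (Fin (n + 1)) k) where
  carrier := {f | ∀ e : Fin (n + 1) →₀ ℕ, (∀ i, i ≠ 0 → e i < N) → coeff e f = 0}
  add_mem' := by
    intro a b ha hb e he
    rw [coeff_add, ha e he, hb e he, add_zero]
  zero_mem' := by
    intro e he
    simp
  smul_mem' := by
    intro c f hf e he
    rw [smul_eq_mul, coeff_mul]
    refine Finset.sum_eq_zero fun x hx => ?_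
    rw [Finset.HasAntidiagonal.mem_antidiagonal] at hx
    rw [hf x.2, mul_zero]
    intro i hi
    have := he i hi
    rw [← hx, Finsupp.add_apply] at this
    omega

lemma mem_bigIdeal {k : Type*} [Field k] {n N : ℕ} {f : MvPolynomial (Fin (n + 1)) k} :
    f ∈ bigIdeal k n N ↔
      ∀ e : Fin (n + 1) →₀ ℕ, (∀ i, i ≠ 0 → e i < N) → coeff e f = 0 := Iff.rfl

lemma X_pow_mem_bigIdeal {k : Type*} [Field k] {n N : ℕ} (i : Fin (n + 1)) (hi : i ≠ 0) :
    (X i ^ N : MvPolynomial (Fin (n + 1)) k) ∈ bigIdeal k n N := by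
  rw [mem_bigIdeal]
  intro e he
  rw [coeff_X_pow, if_neg]
  rintro rfl
  have := he i hi
  simp at this

/-- Elements of `A` which become members of `bigIdeal N` after multiplying by `D^N`. -/
def bigSub (k : Type*) [Field k] (n : ℕ) :
    Submodule (MvPolynomial (Fin (n + 1)) k) (CechLoc k n) where
  carrier := {a | ∃ N₀ : ℕ, ∀ N, N₀ ≤ N → ∃ p ∈ bigIdeal k n N,
    a * algebraMap (MvPolynomial (Fin (n + 1)) k) (CechLoc k n) (cechDenom k n ^ N) =
      algebraMap (MvPolynomial (Fin (n + 1)) k) (CechLoc k n) p}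
  add_mem' := by
    rintro a b ⟨N₁, h₁⟩ ⟨N₂, h₂⟩
    refine ⟨max N₁ N₂, fun N hN => ?_⟩
    obtain ⟨p, hp, hp'⟩ := h₁ N (le_trans (le_max_left _ _) hN)
    obtain ⟨q, hq, hq'⟩ := h₂ N (le_trans (le_max_right _ _) hN)
    exact ⟨p + q, add_mem hp hq, by rw [add_mul, hp', hq', map_add]⟩
  zero_mem' := ⟨0, fun N _ => ⟨0, zero_mem _, by simp⟩⟩
  smul_mem' := by
    rintro c a ⟨N₁, h₁⟩
    refine ⟨N₁, fun N hN => ?_⟩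
    obtain ⟨p, hp, hp'⟩ := h₁ N hN
    exact ⟨c * p, Ideal.mul_mem_left _ _ hp, by rw [Algebra.smul_def, mul_assoc, hp', map_mul]⟩

lemma cechSub_le_bigSub (k : Type*) [Field k] (n : ℕ) (i : Fin (n + 1)) (hi : i ≠ 0) :
    cechSub k n i ≤ bigSub k n := by
  unfold cechSub
  rw [Submodule.span_le]
  rintro a ⟨p, m, h⟩
  refine ⟨m, fun N hN => ?_⟩
  refine ⟨p * (∏ j ∈ (Finset.univ.erase (0 : Fin (n + 1))).erase i, X j) ^ (N - m) * X i ^ N,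
    Ideal.mul_mem_left _ _ (X_pow_mem_bigIdeal i hi), ?_⟩
  have hD : cechDenom k n =
      (∏ j ∈ (Finset.univ.erase (0 : Fin (n + 1))).erase i, X j) * X i := by
    unfold cechDenom
    rw [Finset.prod_erase_mul]
    simpa using hi
  have hDN : cechDenom k n ^ N =
      (∏ j ∈ (Finset.univ.erase (0 : Fin (n + 1))).erase i, X j) ^ N * X i ^ N := by
    rw [hD, mul_pow]
  rw [congrArg (algebraMap (MvPolynomial (Fin (n + 1)) k) (CechLoc k n)) hDN]
  obtain ⟨t, rfl⟩ := Nat.exists_eq_add_of_le hN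
  rw [Nat.add_sub_cancel_left, pow_add, map_mul, map_mul, map_mul, map_mul, ← h]
  ring

lemma cechDenom_eq_monomial (k : Type*) [Field k] (n N : ℕ) :
    cechDenom k n ^ N =
      monomial (∑ j ∈ Finset.univ.erase (0 : Fin (n + 1)), Finsupp.single j N) 1 := by
  unfold cechDenom
  rw [← Finset.prod_pow, monomial_sum_one]
  exact Finset.prod_congr rfl fun j _ => by rw [X_pow_eq_monomial]

lemma expo_apply (n N : ℕ) (i : Fin (n + 1)) :
    (∑ j ∈ Finset.univ.erase (0 : Fin (n + 1)), Finsupp.single j N) i =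
      if i = 0 then 0 else N := by
  rw [Finsupp.finsetSum_apply]
  simp [Finsupp.single_apply]

lemma core (k : Type*) [Field k] [CharZero k] (n N : ℕ)
    (F G : MvPolynomial (Fin (n + 1)) k) (hF : F.IsHomogeneous (n + 1))
    (h0 : coeff (Finsupp.single 0 (n + 1)) F ≠ 0)
    (h : pderiv 0 F * cechDenom k n ^ N - F * G ∈ bigIdeal k n (N + 1)) : False := by
  have hFa : ∀ a, coeff a F ≠ 0 → n + 1 ≤ a 0 → a = Finsupp.single 0 (n + 1) := by
    intro a ha h1
    have hd : a.degree = n + 1 := by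
      by_contra hne
      exact ha (hF.coeff_eq_zero hne)
    rw [Finsupp.degree_eq_sum, Fin.sum_univ_succ] at hd
    have hz : ∑ i : Fin n, a i.succ = 0 := by omega
    have hz' := Finset.sum_eq_zero_iff.1 hz
    ext i
    refine Fin.cases ?_ (fun i => ?_) i
    · simp; omega
    · simp [hz' i (Finset.mem_univ _)]
  have hG : G ∈ bigIdeal k n (N + 1) := by
    by_contra hG
    let T := G.support.filter (fun e => ∀ i, i ≠ 0 → e i < N + 1)
    have hT : T.Nonempty := by
      rw [mem_bigIdeal] at hG
      push Not at hG
      obtain ⟨e, he, he'⟩ := hG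
      exact ⟨e, by simp only [T, Finset.mem_filter, mem_support_iff]; exact ⟨he', he⟩⟩
    obtain ⟨m, hm, hmax⟩ := T.exists_max_image (fun e => e 0) hT
    simp only [T, Finset.mem_filter, mem_support_iff] at hm hmax
    have hc := mem_bigIdeal.1 h (Finsupp.single 0 (n + 1) + m) (by
      intro i hi
      have := hm.2 i hi
      simpa [Finsupp.single_apply, hi.symm] using this)
    have h2 : coeff (Finsupp.single 0 (n + 1) + m) (pderiv 0 F * cechDenom k n ^ N) = 0 := by
      rw [cechDenom_eq_monomial, coeff_mul_monomial']
      split_ifs with hle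
      · rw [mul_one, coeff_pderiv, mul_eq_zero]
        left
        by_contra hne
        have hz := expo_apply n N 0
        rw [if_pos rfl] at hz
        have := hFa _ hne (by
          rw [Finsupp.add_apply, Finsupp.tsub_apply, hz, Finsupp.add_apply,
            Finsupp.single_eq_same]
          omega)
        have := DFunLike.congr_fun this 0
        rw [Finsupp.add_apply, Finsupp.tsub_apply, hz, Finsupp.add_apply,
          Finsupp.single_eq_same, Finsupp.single_eq_same] at this
        omega
      · rfl
    have h3 : coeff (Finsupp.single 0 (n + 1) + m) (F * G) =
        coeff (Finsupp.single 0 (n + 1)) F * coeff m G := by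
      rw [coeff_mul]
      refine Finset.sum_eq_single (Finsupp.single 0 (n + 1), m) ?_ ?_
      · rintro ⟨a, b⟩ hab hne
        rw [Finset.HasAntidiagonal.mem_antidiagonal] at hab
        simp only at hab ⊢
        by_contra hz
        obtain ⟨ha, hb⟩ := mul_ne_zero_iff.1 hz
        have hb0 := hmax b ⟨hb, fun i hi => by
          have h4 := DFunLike.congr_fun hab i
          have h5 := hm.2 i hi
          simp [Finsupp.single_apply, hi.symm] at h4
          omega⟩
        have h4 := DFunLike.congr_fun hab 0
        simp at h4
        have h6 := hFa a ha (by omega)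
        subst h6
        exact hne (by rw [add_left_cancel hab])
      · intro hx
        simp at hx
    rw [coeff_sub, h2, h3, zero_sub, neg_eq_zero] at hc
    exact mul_ne_zero h0 hm.1 hc
  have h7 := add_mem h (Ideal.mul_mem_left _ F hG)
  rw [sub_add_cancel] at h7
  have h8 := mem_bigIdeal.1 h7
    (Finsupp.single 0 n + ∑ j ∈ Finset.univ.erase (0 : Fin (n + 1)), Finsupp.single j N) (by
      intro i hi
      rw [Finsupp.add_apply, expo_apply]
      simp [Finsupp.single_apply, hi.symm, hi])
  rw [cechDenom_eq_monomial, coeff_mul_monomial, mul_one, coeff_pderiv,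
    ← Finsupp.single_add] at h8
  refine mul_ne_zero h0 ?_ h8
  simp only [Finsupp.single_eq_same]
  exact Nat.cast_add_one_ne_zero n

/-- **Nonvanishing half of Lemma 3.1.** For `n ≥ 3` and `F` homogeneous of degree `n+1` with
nonzero coefficient of `x₀^{n+1}`, the Čech cocycle `∂₀F/(x₁⋯xₙ)` does not lie in
`∑_{i=1}^{n} Aᵢ + F·A`, i.e. it represents a nonzero class in `H^{n−1}(X, O_X)`. -/
theorem pderiv_div_not_mem_coboundaries (k : Type*) [Field k] [CharZero k] (n : ℕ)
    (hn : 3 ≤ n) (F : MvPolynomial (Fin (n + 1)) k) (hF : F.IsHomogeneous (n + 1))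
    (h0 : coeff (Finsupp.single 0 (n + 1)) F ≠ 0) :
    (Localization.mk (pderiv 0 F) ⟨cechDenom k n, Submonoid.mem_powers _⟩ : CechLoc k n) ∉
      (⨆ (i : Fin (n + 1)) (_ : i ≠ 0), cechSub k n i) ⊔
        (Ideal.span
            {algebraMap (MvPolynomial (Fin (n + 1)) k) (CechLoc k n) F}).restrictScalars
          (MvPolynomial (Fin (n + 1)) k) := by
  intro hmem
  rw [Submodule.mem_sup] at hmem
  obtain ⟨a, ha, b, hb, hab⟩ := hmem
  have ha' : a ∈ bigSub k n :=
    (iSup₂_le fun i hi => cechSub_le_bigSub k n i hi) ha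
  obtain ⟨N₀, hN⟩ := ha'
  rw [Submodule.restrictScalars_mem, Ideal.mem_span_singleton'] at hb
  obtain ⟨g, rfl⟩ := hb
  obtain ⟨⟨G, s⟩, hs⟩ := IsLocalization.surj (Submonoid.powers (cechDenom k n)) g
  obtain ⟨t, ht⟩ := s.2
  simp only at hs ht
  rw [← ht] at hs
  obtain ⟨p, hp, hp'⟩ := hN (N₀ + t + 1) (by omega)
  have hD : cechDenom k n ≠ 0 := Finset.prod_ne_zero_iff.2 fun j _ => X_ne_zero j
  have hinj : Function.Injective
      (algebraMap (MvPolynomial (Fin (n + 1)) k) (CechLoc k n)) :=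
    IsLocalization.injective _ (powers_le_nonZeroDivisors_of_noZeroDivisors hD)
  have hmk : (Localization.mk (pderiv 0 F) ⟨cechDenom k n, Submonoid.mem_powers _⟩ :
      CechLoc k n) * algebraMap (MvPolynomial (Fin (n + 1)) k) (CechLoc k n) (cechDenom k n) =
      algebraMap (MvPolynomial (Fin (n + 1)) k) (CechLoc k n) (pderiv 0 F) := by
    rw [Localization.mk_eq_mk']
    exact IsLocalization.mk'_spec (CechLoc k n) (pderiv 0 F)
      (⟨cechDenom k n, Submonoid.mem_powers _⟩ : Submonoid.powers (cechDenom k n))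
  refine core k n (N₀ + t) F (G * cechDenom k n ^ (N₀ + 1)) hF h0 ?_
  have hpe : pderiv 0 F * cechDenom k n ^ (N₀ + t) - F * (G * cechDenom k n ^ (N₀ + 1)) = p := by
    apply hinj
    rw [← hp', map_sub, map_mul, ← hmk, ← hab, map_mul, map_mul, ← hs]
    simp only [map_pow]
    ring
  rw [hpe]
  exact hp
end
end

section
/- Let n ≥ 3, let k have characteristic 0, and let F ∈ k[x₀,…,xₙ] be homogeneous of degree n+1 with nonzero coefficient of x₀^{n+1}. Then for every m ∈ ℕ and every p ∈ k[x₀,…,xₙ] homogeneous of degree m·n, there exists c ∈ k such that, in the localization A of k[x₀,…,xₙ] away from x₁⋯xₙ, the element p/(x₁⋯xₙ)^m − c·∂₀F/(x₁⋯xₙ) lies in ∑_{i=1}^{n} Aᵢ + F·A. (Together with the nonvanishing statement, this is Lemma 3.1: H^{n−1}(X, O_X) ≅ k, generated by the Čech cocycle ∂₀F/(x₁⋯xₙ), for the degree-(n+1) hypersurface X = V(F).) -/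
open MvPolynomial

noncomputable section

/-- The inverse of the denominator. -/
def cechInv (k : Type*) [Field k] (n : ℕ) : CechLoc k n :=
  Localization.mk 1 ⟨cechDenom k n, Submonoid.mem_powers _⟩

lemma cechInv_mul (k : Type*) [Field k] (n : ℕ) :
    algebraMap (MvPolynomial (Fin (n + 1)) k) (CechLoc k n) (cechDenom k n) * cechInv k n = 1 := by
  rw [cechInv, ← Localization.mk_one_eq_algebraMap, Localization.mk_mul]
  rw [mul_one, one_mul]
  exact Localization.mk_self (⟨cechDenom k n, Submonoid.mem_powers _⟩ :
    Submonoid.powers (cechDenom k n))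

lemma mk_eq_cechInv (k : Type*) [Field k] (n : ℕ) (p : MvPolynomial (Fin (n + 1)) k) (m : ℕ)
    (d : MvPolynomial (Fin (n + 1)) k) (hd : d = cechDenom k n ^ m)
    (h : d ∈ Submonoid.powers (cechDenom k n)) :
    (Localization.mk p ⟨d, h⟩ : CechLoc k n) =
      algebraMap (MvPolynomial (Fin (n + 1)) k) (CechLoc k n) p * cechInv k n ^ m := by
  subst hd
  have h1 : (Localization.mk p ⟨cechDenom k n ^ m, h⟩ : CechLoc k n) *
      algebraMap (MvPolynomial (Fin (n + 1)) k) (CechLoc k n) (cechDenom k n ^ m) =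
      algebraMap (MvPolynomial (Fin (n + 1)) k) (CechLoc k n) p := by
    rw [Localization.mk_eq_mk']
    exact IsLocalization.mk'_spec (CechLoc k n) p
      (⟨cechDenom k n ^ m, h⟩ : Submonoid.powers (cechDenom k n))
  rw [← h1, mul_assoc, map_pow, ← mul_pow, cechInv_mul, one_pow, mul_one]

/-- The submodule of coboundaries. -/
def cechN (k : Type*) [Field k] (n : ℕ) (F : MvPolynomial (Fin (n + 1)) k) :
    Submodule (MvPolynomial (Fin (n + 1)) k) (CechLoc k n) :=
  (⨆ (i : Fin (n + 1)) (_ : i ≠ 0), cechSub k n i) ⊔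
            (Ideal.span
                {algebraMap (MvPolynomial (Fin (n + 1)) k) (CechLoc k n) F}).restrictScalars
              (MvPolynomial (Fin (n + 1)) k)

/-- Division by the `m`-th power of the denominator. -/
def cechDiv (k : Type*) [Field k] (n m : ℕ) :
    MvPolynomial (Fin (n + 1)) k →ₗ[MvPolynomial (Fin (n + 1)) k] CechLoc k n where
  toFun p := algebraMap (MvPolynomial (Fin (n + 1)) k) (CechLoc k n) p * cechInv k n ^ m
  map_add' p q := by rw [map_add, add_mul]
  map_smul' r p := by
    rw [smul_eq_mul, map_mul, RingHom.id_apply, Algebra.smul_def, mul_assoc]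

lemma cechDiv_apply (k : Type*) [Field k] (n m : ℕ) (p : MvPolynomial (Fin (n + 1)) k) :
    cechDiv k n m p =
      algebraMap (MvPolynomial (Fin (n + 1)) k) (CechLoc k n) p * cechInv k n ^ m := rfl

lemma cechDiv_F_mem (k : Type*) [Field k] (n m : ℕ) (F q : MvPolynomial (Fin (n + 1)) k) :
    cechDiv k n m (q * F) ∈ cechN k n F := by
  apply Submodule.mem_sup_right
  rw [Submodule.restrictScalars_mem, Ideal.mem_span_singleton']
  refine ⟨cechDiv k n m q, ?_⟩
  rw [cechDiv_apply, cechDiv_apply, map_mul]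
  ring

lemma cechDiv_X_mem (k : Type*) [Field k] (n m : ℕ) (F q : MvPolynomial (Fin (n + 1)) k)
    (j : Fin (n + 1)) (hj : j ≠ 0) :
    cechDiv k n m (X j ^ m * q) ∈ cechN k n F := by
  apply Submodule.mem_sup_left
  apply Submodule.mem_iSup_of_mem j
  apply Submodule.mem_iSup_of_mem hj
  apply Submodule.subset_span
  refine ⟨q, m, ?_⟩
  have hD : cechDenom k n = X j * ∏ i ∈ (Finset.univ.erase (0 : Fin (n + 1))).erase j, X i := by
    rw [cechDenom, Finset.mul_prod_erase _ _ (by simp [hj])]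
  have h1 := cechInv_mul k n
  have hD' := congrArg (algebraMap (MvPolynomial (Fin (n + 1)) k) (CechLoc k n)) hD
  rw [map_mul] at hD'
  rw [hD'] at h1
  rw [cechDiv_apply, map_mul, map_pow, map_pow]
  calc _ = algebraMap _ (CechLoc k n) q * (algebraMap (MvPolynomial (Fin (n + 1)) k) (CechLoc k n)
        (X j) * algebraMap _ (CechLoc k n)
          (∏ i ∈ (Finset.univ.erase (0 : Fin (n + 1))).erase j, X i) * cechInv k n) ^ m := by ring
    _ = _ := by rw [h1, one_pow, mul_one]

lemma monomial_mem_of_le (k : Type*) [Field k] (n m : ℕ) (F : MvPolynomial (Fin (n + 1)) k)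
    (e : Fin (n + 1) →₀ ℕ) (a : k) (j : Fin (n + 1)) (hj : j ≠ 0) (he : m ≤ e j) :
    cechDiv k n m (monomial e a) ∈ cechN k n F := by
  have : monomial e a = X j ^ m * monomial (e - Finsupp.single j m) a := by
    rw [X_pow_eq_monomial, monomial_mul, one_mul, add_tsub_cancel_of_le]
    rwa [Finsupp.single_le_iff]
  rw [this]
  exact cechDiv_X_mem k n m F _ j hj

lemma low_monomial (k : Type*) [Field k] (n m : ℕ) (hn : 0 < n)
    (e : Fin (n + 1) →₀ ℕ) (hdeg : e.degree = m * n) (h0 : e 0 ≤ n)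
    (hlt : ∀ j, j ≠ 0 → e j < m) :
    cechDiv k n m (monomial e 1) = cechDiv k n 1 (X 0 ^ n) := by
  have hm : 0 < m := by
    have := hlt (Fin.last n) (by simp [Fin.ext_iff]; omega)
    omega
  obtain ⟨m, rfl⟩ : ∃ l, m = l + 1 := ⟨m - 1, by omega⟩
  have hsum : e 0 + ∑ i : Fin n, e i.succ = (m + 1) * n := by
    rw [← hdeg, Finsupp.degree_eq_sum, Fin.sum_univ_succ]
  have hle : ∀ i ∈ (Finset.univ : Finset (Fin n)), e i.succ ≤ m := fun i _ => by
    have := hlt i.succ (Fin.succ_ne_zero i)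
    omega
  have hb : ∑ i : Fin n, e i.succ ≤ ∑ i : Fin n, m := Finset.sum_le_sum hle
  have hc : ∑ i : Fin n, m = m * n := by simp [mul_comm]
  have hr : (m + 1) * n = m * n + n := by ring
  have heq : ∑ i : Fin n, e i.succ = ∑ i : Fin n, m := by omega
  have he0 : e 0 = n := by omega
  have hall := (Finset.sum_eq_sum_iff_of_le hle).1 heq
  have hmon : (monomial e 1 : MvPolynomial (Fin (n + 1)) k) = X 0 ^ n * cechDenom k n ^ m := by
    rw [monomial_eq, Finsupp.prod_fintype _ _ (by simp), C_1, one_mul, cechDenom,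
      ← Finset.mul_prod_erase _ _ (Finset.mem_univ (0 : Fin (n + 1))), he0, ← Finset.prod_pow]
    congr 1
    apply Finset.prod_congr rfl
    intro j hj
    obtain ⟨i, rfl⟩ := Fin.exists_succ_eq.2 (Finset.ne_of_mem_erase hj)
    rw [hall i (Finset.mem_univ _)]
  have h1 := cechInv_mul k n
  rw [hmon, cechDiv_apply, cechDiv_apply, map_mul, map_pow _ (cechDenom k n)]
  calc _ = algebraMap (MvPolynomial (Fin (n + 1)) k) (CechLoc k n) (X 0 ^ n) * (algebraMap (MvPolynomial (Fin (n + 1)) k)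
        (CechLoc k n) (cechDenom k n) * cechInv k n) ^ m * cechInv k n ^ 1 := by ring
    _ = _ := by rw [h1, one_pow, mul_one]

/-- Being a scalar multiple of `x₀ⁿ/(x₁⋯xₙ)` modulo coboundaries. -/
def cechP (k : Type*) [Field k] (n : ℕ) (F : MvPolynomial (Fin (n + 1)) k)
    (a : CechLoc k n) : Prop :=
  ∃ c : k, a - cechDiv k n 1 (C c * X 0 ^ n) ∈ cechN k n F

lemma cechP_of_mem {k : Type*} [Field k] {n : ℕ} {F : MvPolynomial (Fin (n + 1)) k}
    {a : CechLoc k n} (h : a ∈ cechN k n F) : cechP k n F a :=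
  ⟨0, by simpa using h⟩

lemma cechP_add {k : Type*} [Field k] {n : ℕ} {F : MvPolynomial (Fin (n + 1)) k}
    {a b : CechLoc k n} (ha : cechP k n F a) (hb : cechP k n F b) : cechP k n F (a + b) := by
  obtain ⟨c, hc⟩ := ha
  obtain ⟨d, hd⟩ := hb
  refine ⟨c + d, ?_⟩
  have := add_mem hc hd
  rw [C_add, add_mul, map_add]
  convert this using 1
  abel

lemma cechP_smul {k : Type*} [Field k] {n : ℕ} {F : MvPolynomial (Fin (n + 1)) k}
    {a : CechLoc k n} (t : k) (ha : cechP k n F a) :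
    cechP k n F ((C t : MvPolynomial (Fin (n + 1)) k) • a) := by
  obtain ⟨c, hc⟩ := ha
  refine ⟨t * c, ?_⟩
  have := Submodule.smul_mem _ (C t : MvPolynomial (Fin (n + 1)) k) hc
  rw [smul_sub, ← map_smul, smul_eq_mul, ← mul_assoc, ← C_mul] at this
  exact this

lemma cechP_sum {k : Type*} [Field k] {n : ℕ} {F : MvPolynomial (Fin (n + 1)) k}
    {ι : Type*} (s : Finset ι) (f : ι → CechLoc k n) (h : ∀ i ∈ s, cechP k n F (f i)) :
    cechP k n F (∑ i ∈ s, f i) := by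
  classical
  induction s using Finset.induction_on with
  | empty => simpa using cechP_of_mem (zero_mem _)
  | insert a s ha ih =>
    rw [Finset.sum_insert ha]
    exact cechP_add (h a (by simp)) (ih fun i hi => h i (by simp [hi]))

lemma cechDiv_monomial_smul (k : Type*) [Field k] (n m : ℕ) (e : Fin (n + 1) →₀ ℕ) (a : k) :
    cechDiv k n m (monomial e a) =
      (C a : MvPolynomial (Fin (n + 1)) k) • cechDiv k n m (monomial e 1) := by
  rw [← map_smul, smul_eq_mul, C_mul_monomial, mul_one]

lemma eq_single_of_degree {n d : ℕ} (f : Fin (n + 1) →₀ ℕ) (hf : f.degree = d)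
    (h : d ≤ f 0) : f = Finsupp.single 0 d := by
  rw [Finsupp.degree_eq_sum, Fin.sum_univ_succ] at hf
  have h2 : ∑ i : Fin n, f i.succ = 0 := by omega
  rw [Finset.sum_eq_zero_iff] at h2
  ext i
  refine Fin.cases ?_ (fun i => ?_) i
  · simp; omega
  · simp [h2 i (Finset.mem_univ _), Fin.succ_ne_zero]

lemma cechP_monomial {k : Type*} [Field k] {n : ℕ} (hn : 0 < n)
    {F : MvPolynomial (Fin (n + 1)) k} (hF : F.IsHomogeneous (n + 1))
    (h0 : coeff (Finsupp.single 0 (n + 1)) F ≠ 0) (m : ℕ) :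
    ∀ (d : ℕ) (e : Fin (n + 1) →₀ ℕ), e 0 = d → e.degree = m * n →
      cechP k n F (cechDiv k n m (monomial e 1)) := by
  intro d
  induction d using Nat.strong_induction_on with
  | _ d ih =>
  intro e hed hdeg
  by_cases hj : ∃ j, j ≠ 0 ∧ m ≤ e j
  · obtain ⟨j, hj, hm⟩ := hj
    exact cechP_of_mem (monomial_mem_of_le k n m F e 1 j hj hm)
  push Not at hj
  by_cases hen : e 0 ≤ n
  · rw [low_monomial k n m hn e hdeg hen hj]
    exact ⟨1, by simp⟩
  push Not at hen
  set a := coeff (Finsupp.single 0 (n + 1)) F with ha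
  set s : Fin (n + 1) →₀ ℕ := Finsupp.single 0 (n + 1) with hs
  have hle : s ≤ e := by rw [hs, Finsupp.single_le_iff]; omega
  have hes : (e - s) + s = e := tsub_add_cancel_of_le hle
  have hFsum : F = monomial s a + ∑ f ∈ F.support.erase s, monomial f (coeff f F) := by
    conv_lhs => rw [F.as_sum]
    rw [← Finset.add_sum_erase _ _ (mem_support_iff.2 h0)]
  have hkey : (monomial e 1 : MvPolynomial (Fin (n + 1)) k) =
      (monomial (e - s) a⁻¹) * F +
        ∑ f ∈ F.support.erase s, monomial ((e - s) + f) (- a⁻¹ * coeff f F) := by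
    conv_rhs => rw [hFsum]
    rw [mul_add, monomial_mul, hes, inv_mul_cancel₀ h0, Finset.mul_sum, add_assoc,
      ← hFsum, ← Finset.sum_add_distrib]
    rw [Finset.sum_eq_zero, add_zero]
    intro f _
    rw [monomial_mul, ← map_add]
    simp
  rw [hkey, map_add, map_sum]
  refine cechP_add (cechP_of_mem (cechDiv_F_mem k n m F _)) (cechP_sum _ _ fun f hf => ?_)
  rw [cechDiv_monomial_smul]
  apply cechP_smul
  obtain ⟨hfs, hfF⟩ := Finset.mem_erase.1 hf
  have hfd : f.degree = n + 1 := by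
    by_contra hne
    exact mem_support_iff.1 hfF (hF.coeff_eq_zero hne)
  have hf0 : f 0 < n + 1 := by
    by_contra hlt
    exact hfs (eq_single_of_degree f hfd (by omega))
  refine ih _ ?_ _ rfl ?_
  · have h1 : (e - s) 0 = e 0 - (n + 1) := by simp [hs]
    rw [Finsupp.add_apply, h1]
    omega
  · rw [← hdeg, ← hes, map_add, map_add, hfd, hs, Finsupp.degree_single]
    simp

lemma cechDiv_deg_n {k : Type*} [Field k] {n : ℕ} {F : MvPolynomial (Fin (n + 1)) k}
    (q : MvPolynomial (Fin (n + 1)) k) (hq : q.IsHomogeneous n) :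
    cechDiv k n 1 q - cechDiv k n 1 (C (coeff (Finsupp.single 0 n) q) * X 0 ^ n) ∈
      cechN k n F := by
  rw [C_mul_X_pow_eq_monomial]
  set s : Fin (n + 1) →₀ ℕ := Finsupp.single 0 n with hs
  have hsum : ∑ f ∈ q.support.erase s, monomial f (coeff f q) = q - monomial s (coeff s q) := by
    by_cases h : s ∈ q.support
    · rw [eq_sub_iff_add_eq, Finset.sum_erase_add _ _ h, ← q.as_sum]
    · rw [Finset.erase_eq_of_notMem h, notMem_support_iff.1 h, ← q.as_sum]
      simp
  rw [← map_sub, ← hsum, map_sum]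
  refine sum_mem fun f hf => ?_
  obtain ⟨hfs, hfF⟩ := Finset.mem_erase.1 hf
  have hfd : f.degree = n := by
    by_contra hne
    exact mem_support_iff.1 hfF (hq.coeff_eq_zero hne)
  have : ∃ j, j ≠ 0 ∧ 1 ≤ f j := by
    by_contra hcon
    push Not at hcon
    apply hfs
    apply eq_single_of_degree f hfd
    have hfd' := hfd
    rw [Finsupp.degree_eq_sum, Fin.sum_univ_succ, Finset.sum_eq_zero] at hfd'
    · omega
    · intro i _
      have := hcon i.succ (Fin.succ_ne_zero i)
      omega
  obtain ⟨j, hj, h1⟩ := this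
  exact monomial_mem_of_le k n 1 F f _ j hj h1

lemma coeff_pderiv_single {k : Type*} [Field k] {n : ℕ} (F : MvPolynomial (Fin (n + 1)) k) :
    coeff (Finsupp.single 0 n) (pderiv 0 F) =
      coeff (Finsupp.single 0 (n + 1)) F * ((n + 1 : ℕ) : k) := by
  rw [coeff_pderiv, ← Finsupp.single_add]
  simp

/-- **Generation half of Lemma 3.1.** For `n ≥ 3` and `F` homogeneous of degree `n+1` with
nonzero coefficient of `x₀^{n+1}`, every Čech cochain `p/(x₁⋯xₙ)ᵐ` with `p` homogeneous of
degree `m·n` agrees, modulo `∑_{i=1}^{n} Aᵢ + F·A`, with a scalar multiple `c·∂₀F/(x₁⋯xₙ)`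
of the generating cocycle: `H^{n−1}(X, O_X) ≅ k`. -/
theorem exists_scalar_pderiv_div (k : Type*) [Field k] [CharZero k] (n : ℕ)
    (hn : 3 ≤ n) (F : MvPolynomial (Fin (n + 1)) k) (hF : F.IsHomogeneous (n + 1))
    (h0 : coeff (Finsupp.single 0 (n + 1)) F ≠ 0) :
    ∀ (m : ℕ) (p : MvPolynomial (Fin (n + 1)) k), p.IsHomogeneous (m * n) →
      ∃ c : k,
        (Localization.mk p ⟨cechDenom k n ^ m, Submonoid.pow_mem _ (Submonoid.mem_powers _) m⟩ :
              CechLoc k n) -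
            Localization.mk (C c * pderiv 0 F) ⟨cechDenom k n, Submonoid.mem_powers _⟩ ∈
          (⨆ (i : Fin (n + 1)) (_ : i ≠ 0), cechSub k n i) ⊔
            (Ideal.span
                {algebraMap (MvPolynomial (Fin (n + 1)) k) (CechLoc k n) F}).restrictScalars
              (MvPolynomial (Fin (n + 1)) k) := by
  intro m p hp
  have hn0 : 0 < n := by omega
  have hP : cechP k n F (cechDiv k n m p) := by
    rw [p.as_sum, map_sum]
    refine cechP_sum _ _ fun f hf => ?_
    rw [cechDiv_monomial_smul]
    apply cechP_smul
    refine cechP_monomial hn0 hF h0 m _ f rfl ?_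
    by_contra hne
    exact mem_support_iff.1 hf (hp.coeff_eq_zero hne)
  obtain ⟨c, hc⟩ := hP
  have hq : (pderiv 0 F).IsHomogeneous n := by
    simpa using hF.pderiv (i := 0)
  have h2 := cechDiv_deg_n (F := F) _ hq
  set b := coeff (Finsupp.single 0 n) (pderiv 0 F) with hb
  have hb0 : b ≠ 0 := by
    rw [hb, coeff_pderiv_single]
    exact mul_ne_zero h0 (Nat.cast_ne_zero.2 (by omega))
  refine ⟨c * b⁻¹, ?_⟩
  rw [mk_eq_cechInv k n p m _ rfl, mk_eq_cechInv k n _ 1 _ (pow_one _).symm]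
  rw [← cechDiv_apply, ← cechDiv_apply]
  change _ ∈ cechN k n F
  have h3 := Submodule.smul_mem _ (C (c * b⁻¹) : MvPolynomial (Fin (n + 1)) k) h2
  rw [smul_sub, ← map_smul (cechDiv k n 1), ← map_smul (cechDiv k n 1), smul_eq_mul, smul_eq_mul, ← mul_assoc, ← C_mul,
    mul_assoc c, inv_mul_cancel₀ hb0, mul_one] at h3
  have h4 := sub_mem hc h3
  convert h4 using 1
  abel
end
end

section
/- Let n ≥ 3, let k have characteristic 0, and let F ∈ k[x₀,…,xₙ] be homogeneous of degree n+1 with nonzero coefficient of x₀^{n+1}. Let D be the derivation (∂₀F)·∂ₙ − (∂ₙF)·∂₀ of k[x₀,…,xₙ], and let D′ : A → A be any k-derivation of the localization A of k[x₀,…,xₙ] away from x₁⋯xₙ that extends D (i.e. D′ agrees with D on the image of k[x₀,…,xₙ] in A). Then the element (x_{n−1}/xₙ) · D′(xₙ/x_{n−1}) · (x₁⋯x_{n−1})^{−1} of A equals ∂₀F/(x₁⋯xₙ), and it does not lie in the submodule ∑_{i=1}^{n} Aᵢ + F·A. (This is the central computation of the paper, proving Theorem 3.4: the image of the transition cocycle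 x_n/x_{n−1} of O(−1)|_X under the log differential of the generating Čech derivation is the nonzero class ∂₀F/(x₁⋯xₙ) ∈ H^{n−1}(X, O_X), so O(1)|_X does not extend to the corresponding deformation of X.) -/
open MvPolynomial

noncomputable section

lemma cechDenom_eq_prod_succ (k : Type*) [Field k] (n : ℕ) :
    cechDenom k n = ∏ j : Fin n, X j.succ := by
  unfold cechDenom
  rw [Fin.univ_succ, Finset.erase_cons, Finset.prod_map]
  rfl

lemma finSuccEquiv_cechDenom (k : Type*) [Field k] (n : ℕ) :
    finSuccEquiv k n (cechDenom k n) = Polynomial.C (∏ j : Fin n, X j) := by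
  rw [cechDenom_eq_prod_succ, map_prod, map_prod]
  simp only [finSuccEquiv_X_succ]

lemma finSuccEquiv_pderiv_zero (k : Type*) [Field k] (n : ℕ)
    (f : MvPolynomial (Fin (n + 1)) k) :
    finSuccEquiv k n (pderiv 0 f) = Polynomial.derivative (finSuccEquiv k n f) := by
  induction f using MvPolynomial.induction_on with
  | C a =>
    rw [pderiv_C, map_zero, finSuccEquiv_apply, eval₂Hom_C]
    simp
  | add p q hp hq => simp only [map_add, hp, hq]
  | mul_X p i hp =>
    have hX : finSuccEquiv k n (pderiv 0 (X i)) =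
        Polynomial.derivative (finSuccEquiv k n (X i)) := by
      refine Fin.cases ?_ (fun j => ?_) i
      · rw [pderiv_X_self, finSuccEquiv_X_zero, Polynomial.derivative_X, map_one]
      · rw [pderiv_X_of_ne (Fin.succ_ne_zero j), finSuccEquiv_X_succ, Polynomial.derivative_C,
          map_zero]
    rw [pderiv_mul, map_add, map_mul, map_mul, hp, map_mul, Polynomial.derivative_mul, hX]

/-- The monomial ideal `(x₁^N, …, xₙ^N)`. -/
def powIdeal (k : Type*) [Field k] (n N : ℕ) : Ideal (MvPolynomial (Fin n) k) :=
  Ideal.span ((fun s => monomial s (1 : k)) '' Set.range (fun j : Fin n => Finsupp.single j N))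

lemma prod_pow_notMem_powIdeal (k : Type*) [Field k] (n N : ℕ) (c : k) (hc : c ≠ 0) :
    (∏ j : Fin n, X j) ^ N * C c ∉ powIdeal k n (N + 1) := by
  intro h
  have h' : (∏ j : Fin n, X j) ^ N ∈ powIdeal k n (N + 1) := by
    have := (powIdeal k n (N + 1)).mul_mem_right (C c⁻¹) h
    rwa [mul_assoc, ← C_mul, mul_inv_cancel₀ hc, C_1, mul_one] at this
  rw [← Finset.prod_pow, prod_X_pow (fun _ => N), powIdeal, mem_ideal_span_monomial_image] at h'
  obtain ⟨s, ⟨j, rfl⟩, hs⟩ := h' _ (by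
    rw [mem_support_iff, coeff_monomial, if_pos rfl]; exact one_ne_zero)
  have := hs j
  simp at this

/-- Reduction `k[x₀,…,xₙ] → (k[x₁,…,xₙ]/(x₁^N,…,xₙ^N))[x₀]`. -/
def redHom (k : Type*) [Field k] (n N : ℕ) :
    MvPolynomial (Fin (n + 1)) k →+* Polynomial (MvPolynomial (Fin n) k ⧸ powIdeal k n N) :=
  (Polynomial.mapRingHom (Ideal.Quotient.mk (powIdeal k n N))).comp
    (finSuccEquiv k n : MvPolynomial (Fin (n + 1)) k →+* Polynomial (MvPolynomial (Fin n) k))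

lemma redHom_apply (k : Type*) [Field k] (n N : ℕ) (f : MvPolynomial (Fin (n + 1)) k) :
    redHom k n N f = (finSuccEquiv k n f).map (Ideal.Quotient.mk (powIdeal k n N)) := rfl

lemma redHom_X_pow (k : Type*) [Field k] (n N : ℕ) (i : Fin (n + 1)) (hi : i ≠ 0) :
    redHom k n N (X i ^ N) = 0 := by
  obtain ⟨j, rfl⟩ := Fin.exists_succ_eq.mpr hi
  rw [redHom_apply, map_pow, finSuccEquiv_X_succ, ← Polynomial.C_pow, Polynomial.map_C,
    Polynomial.C_eq_zero, Ideal.Quotient.eq_zero_iff_mem]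
  apply Ideal.subset_span
  exact ⟨_, ⟨j, rfl⟩, by simp [X_pow_eq_monomial]⟩

/-- The key nonvanishing. -/
lemma key_nonvanishing (k : Type*) [Field k] [CharZero k] (n : ℕ)
    (F : MvPolynomial (Fin (n + 1)) k) (hF : F.IsHomogeneous (n + 1))
    (h0 : coeff (Finsupp.single 0 (n + 1)) F ≠ 0) (N : ℕ)
    (B : MvPolynomial (Fin (n + 1)) k) :
    redHom k n (N + 1) (cechDenom k n ^ N * pderiv 0 F) ≠ redHom k n (N + 1) (F * B) := by
  set c := coeff (Finsupp.single 0 (n + 1)) F with hc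
  set G := finSuccEquiv k n F with hG
  have hdeg : G.natDegree ≤ n + 1 := by
    rw [hG, natDegree_finSuccEquiv]
    exact (degreeOf_le_totalDegree F 0).trans hF.totalDegree_le
  have hcoef : G.coeff (n + 1) = C c := by
    ext m
    rw [hG, finSuccEquiv_coeff_coeff, coeff_C]
    split_ifs with hm
    · subst hm
      rw [hc]
      congr 1
      ext i
      refine Fin.cases ?_ (fun j => ?_) i
      · simp
      · simp [Finsupp.single_apply, (Fin.succ_ne_zero j).symm]
    · by_contra hne
      have h1 := hF hne
      apply hm
      rw [Finsupp.weight_apply, Finsupp.sum_fintype _ _ (by simp), Fin.sum_univ_succ] at h1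
      simp at h1
      ext j
      simp [h1 j]
  set π := Ideal.Quotient.mk (powIdeal k n (N + 1)) with hπ
  have hnot : π ((∏ j : Fin n, X j) ^ N * C (c * ((n : k) + 1))) ≠ 0 := by
    rw [Ne, hπ, Ideal.Quotient.eq_zero_iff_mem]
    exact prod_pow_notMem_powIdeal k n N _ (mul_ne_zero h0 (by exact_mod_cast Nat.succ_ne_zero n))
  have hnt : Nontrivial (MvPolynomial (Fin n) k ⧸ powIdeal k n (N + 1)) := ⟨⟨_, _, hnot⟩⟩
  set u := π (C c⁻¹)
  have hu : π (C c) * u = 1 := by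
    rw [← map_mul, ← C_mul, mul_inv_cancel₀ h0, C_1, map_one]
  set M := G.map π * Polynomial.C u with hM
  have hMdeg : M.natDegree ≤ n + 1 := by
    refine (Polynomial.natDegree_mul_C_le _ _).trans ?_
    exact Polynomial.natDegree_map_le.trans hdeg
  have hMc : M.coeff (n + 1) = 1 := by
    rw [hM, Polynomial.coeff_mul_C, Polynomial.coeff_map, hcoef, hu]
  have hMm : M.Monic := Polynomial.monic_of_natDegree_le_of_coeff_eq_one _ hMdeg hMc
  have hMd : M.natDegree = n + 1 :=
    le_antisymm hMdeg (Polynomial.le_natDegree_of_ne_zero (by rw [hMc]; exact one_ne_zero))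
  set Q := redHom k n (N + 1) (cechDenom k n ^ N * pderiv 0 F) with hQ
  have hQ' : Q = (Polynomial.C ((∏ j : Fin n, X j) ^ N) * Polynomial.derivative G).map π := by
    rw [hQ, redHom_apply, map_mul, map_pow, finSuccEquiv_cechDenom, finSuccEquiv_pderiv_zero,
      ← Polynomial.C_pow]
  have hQc : Q.coeff n ≠ 0 := by
    rw [hQ', Polynomial.coeff_map, Polynomial.coeff_C_mul, Polynomial.coeff_derivative, hcoef]
    convert hnot using 3
    simp
  have hQd : Q.natDegree < M.natDegree := by
    rw [hMd, hQ']
    refine Nat.lt_succ_of_le (Polynomial.natDegree_map_le.trans ?_)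
    refine (Polynomial.natDegree_C_mul_le _ _).trans ?_
    exact (Polynomial.natDegree_derivative_le G).trans (by omega)
  intro heq
  refine hMm.not_dvd_of_natDegree_lt (fun h => hQc (by rw [h, Polynomial.coeff_zero])) hQd ?_
  refine ⟨Polynomial.C (π (C c)) * redHom k n (N + 1) B, ?_⟩
  rw [heq, map_mul, redHom_apply k n (N + 1) F, hM]
  have : Polynomial.C u * Polynomial.C (π (C c)) = 1 := by
    rw [← Polynomial.C_mul, mul_comm, hu, Polynomial.C_1]
  linear_combination (-(G.map π) * redHom k n (N + 1) B) * this

/-- Elements killed by the reduction, after clearing denominators. -/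
def goodSub (k : Type*) [Field k] (n : ℕ) :
    Submodule (MvPolynomial (Fin (n + 1)) k) (CechLoc k n) where
  carrier := {a | ∃ N₀ : ℕ, ∀ N ≥ N₀, ∃ q : MvPolynomial (Fin (n + 1)) k,
    redHom k n N q = 0 ∧ a * algebraMap _ (CechLoc k n) (cechDenom k n ^ N) = algebraMap _ _ q}
  zero_mem' := ⟨0, fun N _ => ⟨0, by simp, by simp⟩⟩
  add_mem' := by
    rintro a b ⟨N₁, h₁⟩ ⟨N₂, h₂⟩
    refine ⟨max N₁ N₂, fun N hN => ?_⟩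
    obtain ⟨q₁, hq₁, e₁⟩ := h₁ N (le_trans (le_max_left _ _) hN)
    obtain ⟨q₂, hq₂, e₂⟩ := h₂ N (le_trans (le_max_right _ _) hN)
    exact ⟨q₁ + q₂, by rw [map_add, hq₁, hq₂, add_zero], by rw [add_mul, e₁, e₂, map_add]⟩
  smul_mem' := by
    rintro r a ⟨N₁, h₁⟩
    refine ⟨N₁, fun N hN => ?_⟩
    obtain ⟨q₁, hq₁, e₁⟩ := h₁ N hN
    exact ⟨r * q₁, by rw [map_mul, hq₁, mul_zero],
      by rw [Algebra.smul_def, mul_assoc, e₁, map_mul]⟩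

lemma cechSub_le_goodSub (k : Type*) [Field k] (n : ℕ) (i : Fin (n + 1)) (hi : i ≠ 0) :
    cechSub k n i ≤ goodSub k n := by
  refine Submodule.span_le.mpr ?_
  rintro a ⟨p, m, h⟩
  refine ⟨m, fun N hN => ?_⟩
  set E : MvPolynomial (Fin (n + 1)) k :=
    ∏ j ∈ (Finset.univ.erase (0 : Fin (n + 1))).erase i, X j with hE
  have hP : cechDenom k n = X i * E :=
    (Finset.mul_prod_erase _ _ (Finset.mem_erase.mpr ⟨hi, Finset.mem_univ i⟩)).symm
  refine ⟨X i ^ N * (E ^ (N - m) * p), by rw [map_mul, redHom_X_pow k n N i hi, zero_mul], ?_⟩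
  have : cechDenom k n ^ N = E ^ m * (X i ^ N * E ^ (N - m)) := by
    rw [hP, mul_pow, mul_left_comm, ← pow_add, Nat.add_sub_cancel' hN]
  rw [this, map_mul, ← mul_assoc, h, ← map_mul]
  congr 1
  ring

lemma algebraMap_cechLoc_injective (k : Type*) [Field k] (n : ℕ) :
    Function.Injective (algebraMap (MvPolynomial (Fin (n + 1)) k) (CechLoc k n)) :=
  IsLocalization.injective _ (powers_le_nonZeroDivisors_of_noZeroDivisors (cechDenom_ne_zero k n))

lemma mk_mul_cechDenom (k : Type*) [Field k] (n : ℕ) (p : MvPolynomial (Fin (n + 1)) k) :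
    (Localization.mk p ⟨cechDenom k n, Submonoid.mem_powers _⟩ : CechLoc k n) *
      algebraMap _ (CechLoc k n) (cechDenom k n) = algebraMap _ (CechLoc k n) p := by
  rw [Localization.mk_eq_mk']
  exact IsLocalization.mk'_spec _ p
    (⟨cechDenom k n, Submonoid.mem_powers _⟩ : Submonoid.powers (cechDenom k n))

lemma not_mem_part (k : Type*) [Field k] [CharZero k] (n : ℕ)
    (F : MvPolynomial (Fin (n + 1)) k) (hF : F.IsHomogeneous (n + 1))
    (h0 : coeff (Finsupp.single 0 (n + 1)) F ≠ 0) :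
    (Localization.mk (pderiv 0 F) ⟨cechDenom k n, Submonoid.mem_powers _⟩ : CechLoc k n) ∉
      (⨆ (i : Fin (n + 1)) (_ : i ≠ 0), cechSub k n i) ⊔
        (Ideal.span
            {algebraMap (MvPolynomial (Fin (n + 1)) k) (CechLoc k n) F}).restrictScalars
          (MvPolynomial (Fin (n + 1)) k) := by
  intro h
  obtain ⟨y, hy, z, hz, hyz⟩ := Submodule.mem_sup.mp h
  have hle : (⨆ (i : Fin (n + 1)) (_ : i ≠ 0), cechSub k n i) ≤ goodSub k n :=
    iSup₂_le fun i hi => cechSub_le_goodSub k n i hi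
  obtain ⟨N₀, hN₀⟩ := hle hy
  rw [Submodule.restrictScalars_mem] at hz
  obtain ⟨b, rfl⟩ := Ideal.mem_span_singleton'.mp hz
  obtain ⟨M, B, hB⟩ := IsLocalization.Away.surj (cechDenom k n) b
  obtain ⟨q, hq, hqe⟩ := hN₀ (N₀ + M + 1) (by omega)
  apply key_nonvanishing k n F hF h0 (N₀ + M) (B * cechDenom k n ^ (N₀ + 1))
  have : cechDenom k n ^ (N₀ + M) * pderiv 0 F = q + F * (B * cechDenom k n ^ (N₀ + 1)) := by
    apply algebraMap_cechLoc_injective k n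
    have e := mk_mul_cechDenom k n (pderiv 0 F)
    rw [← hyz] at e
    simp only [map_mul, map_add, map_pow] at hqe e ⊢
    rw [← hqe, ← hB, ← e]
    ring
  rw [this, map_add, hq, zero_add]

/-- **The central computation (Theorem 3.4).** Let `D = (∂₀F)·∂ₙ − (∂ₙF)·∂₀` and let
`D' : A → A` be any `k`-derivation of the localization `A` extending `D`.  Then
`(x_{n−1}/xₙ) · D'(xₙ/x_{n−1}) · (x₁⋯x_{n−1})⁻¹ = ∂₀F/(x₁⋯xₙ)` in `A`, and this element does
not lie in `∑_{i=1}^{n} Aᵢ + F·A`: the image of the transition cocycle of `O(−1)|_X` under the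
log differential of the generating Čech derivation is a nonzero class in `H^{n−1}(X, O_X)`.
Here `x_{n−1}/xₙ = x_{n−1}·(x₁⋯x_{n−1})/(x₁⋯xₙ)`, `xₙ/x_{n−1} = xₙ·(x₁⋯x̂_{n−1}⋯xₙ)/(x₁⋯xₙ)`
and `(x₁⋯x_{n−1})⁻¹ = xₙ/(x₁⋯xₙ)`. -/
theorem log_differential_of_transition_cocycle (k : Type*) [Field k] [CharZero k] (n : ℕ)
    (hn : 3 ≤ n) (F : MvPolynomial (Fin (n + 1)) k) (hF : F.IsHomogeneous (n + 1))
    (h0 : coeff (Finsupp.single 0 (n + 1)) F ≠ 0)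
    (D' : CechLoc k n → CechLoc k n)
    (hadd : ∀ a b, D' (a + b) = D' a + D' b)
    (hleib : ∀ a b, D' (a * b) = a * D' b + b * D' a)
    (hconst : ∀ c : k, D' (algebraMap (MvPolynomial (Fin (n + 1)) k) (CechLoc k n) (C c)) = 0)
    (hext : ∀ r : MvPolynomial (Fin (n + 1)) k,
      D' (algebraMap (MvPolynomial (Fin (n + 1)) k) (CechLoc k n) r) =
        algebraMap (MvPolynomial (Fin (n + 1)) k) (CechLoc k n)
          ((pderiv 0 F • pderiv (Fin.last n) - pderiv (Fin.last n) F • pderiv 0 :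
            Derivation k (MvPolynomial (Fin (n + 1)) k) (MvPolynomial (Fin (n + 1)) k)) r)) :
    (Localization.mk
          (X (⟨n - 1, by omega⟩ : Fin (n + 1)) *
            ∏ j ∈ (Finset.univ.erase (0 : Fin (n + 1))).erase (Fin.last n), X j)
          ⟨cechDenom k n, Submonoid.mem_powers _⟩ : CechLoc k n) *
        D' (Localization.mk
          (X (Fin.last n) *
            ∏ j ∈ (Finset.univ.erase (0 : Fin (n + 1))).erase ⟨n - 1, by omega⟩, X j)
          ⟨cechDenom k n, Submonoid.mem_powers _⟩) *
        Localization.mk (X (Fin.last n)) ⟨cechDenom k n, Submonoid.mem_powers _⟩ =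
      Localization.mk (pderiv 0 F) ⟨cechDenom k n, Submonoid.mem_powers _⟩ ∧
    (Localization.mk (pderiv 0 F) ⟨cechDenom k n, Submonoid.mem_powers _⟩ : CechLoc k n) ∉
      (⨆ (i : Fin (n + 1)) (_ : i ≠ 0), cechSub k n i) ⊔
        (Ideal.span
            {algebraMap (MvPolynomial (Fin (n + 1)) k) (CechLoc k n) F}).restrictScalars
          (MvPolynomial (Fin (n + 1)) k) := by
  refine ⟨?_, not_mem_part k n F hF h0⟩
  set α := algebraMap (MvPolynomial (Fin (n + 1)) k) (CechLoc k n) with hα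
  set i : Fin (n + 1) := ⟨n - 1, by omega⟩ with hi
  have hi0 : i ≠ 0 := by
    rw [Ne, Fin.ext_iff]; simp [hi]; omega
  have hil : i ≠ Fin.last n := by
    rw [Ne, Fin.ext_iff]; simp [hi]; omega
  have hl0 : Fin.last n ≠ 0 := by
    rw [Ne, Fin.ext_iff]; simp; omega
  have hP (j : Fin (n + 1)) (hj : j ≠ 0) : X j *
      (∏ j ∈ (Finset.univ.erase (0 : Fin (n + 1))).erase j, X j) = cechDenom k n :=
    Finset.mul_prod_erase _ _ (Finset.mem_erase.mpr ⟨hj, Finset.mem_univ j⟩)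
  have hPi := congrArg α (hP i hi0)
  have hPl := congrArg α (hP _ hl0)
  set Ei : MvPolynomial (Fin (n + 1)) k :=
    ∏ j ∈ (Finset.univ.erase (0 : Fin (n + 1))).erase i, X j
  set El : MvPolynomial (Fin (n + 1)) k :=
    ∏ j ∈ (Finset.univ.erase (0 : Fin (n + 1))).erase (Fin.last n), X j
  have e1 := mk_mul_cechDenom k n (X i * El)
  have e2 := mk_mul_cechDenom k n (X (Fin.last n) * Ei)
  have e3 := mk_mul_cechDenom k n (X (Fin.last n))
  have e4 := mk_mul_cechDenom k n (pderiv 0 F)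
  set a1 : CechLoc k n := Localization.mk (X i * El) ⟨cechDenom k n, Submonoid.mem_powers _⟩
  set a2 : CechLoc k n :=
    Localization.mk (X (Fin.last n) * Ei) ⟨cechDenom k n, Submonoid.mem_powers _⟩
  set a3 : CechLoc k n :=
    Localization.mk (X (Fin.last n)) ⟨cechDenom k n, Submonoid.mem_powers _⟩
  set a4 : CechLoc k n :=
    Localization.mk (pderiv 0 F) ⟨cechDenom k n, Submonoid.mem_powers _⟩
  have hU : IsUnit (α (cechDenom k n)) := IsLocalization.Away.algebraMap_isUnit _
  rw [← hα] at e1 e2 e3 e4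
  rw [map_mul] at hPi hPl e1 e2
  have e5 : a2 * α (X i) = α (X (Fin.last n)) := by
    apply hU.mul_right_cancel
    rw [← hPi]
    rw [← hPi] at e2
    linear_combination (α (X i)) * e2
  have e6 := congrArg D' e5
  rw [hleib, hext, hext] at e6
  simp only [Derivation.sub_apply, Derivation.smul_apply, pderiv_X_self,
    pderiv_X_of_ne hi0, pderiv_X_of_ne hil, pderiv_X_of_ne hl0, smul_zero, sub_zero, map_zero,
    mul_zero, zero_add, smul_eq_mul, mul_one] at e6
  apply hU.mul_right_cancel
  apply hU.mul_right_cancel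
  rw [e4, ← e6]
  calc a1 * D' a2 * a3 * α (cechDenom k n) * α (cechDenom k n)
      = (a1 * α (cechDenom k n)) * D' a2 * (a3 * α (cechDenom k n)) := by ring
    _ = α (X i) * D' a2 * (α (X (Fin.last n)) * α El) := by rw [e1, e3]; ring
    _ = _ := by rw [hPl]
end
end
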